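/- Fix n ∈ ℕ, d ≥ 2, and a compact basic semialgebraic set X ⊆ ℝ^m whose quadratic module Q(X) is Archimedean. Then the SOS-monotone games of degree d over X are dense in the monotone games of degree d over X: for every degree-d game G that is monotone over X and every ε > 0, there exists a degree-d game G′ that is SOS-monotone (i.e., −yᵀ SJ_{G′}(x) y ∈ Q_ℓ(X × B) for some ℓ ∈ ℕ) with ‖G − G′‖ ≤ ε, where ‖G − G′‖ = max_i ‖coeffs(u_i) − coeffs(u′_i)‖_∞. -/

import Mathlib

open MvPolynomial Finset

noncomputable section

/-- `p` is a sum of squares of polynomials. -/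
def IsSOS {σ : Type*} (p : MvPolynomial σ ℝ) : Prop :=
  ∃ (k : ℕ) (q : Fin k → MvPolynomial σ ℝ), p = ∑ i, q i ^ 2

/-- Membership in the quadratic module generated by the inequality polynomials `g`
and the equality polynomials `h`. -/
def InQM {σ ιg ιh : Type*} [Fintype ιg] [Fintype ιh]
    (g : ιg → MvPolynomial σ ℝ) (h : ιh → MvPolynomial σ ℝ)
    (p : MvPolynomial σ ℝ) : Prop :=
  ∃ (s0 : MvPolynomial σ ℝ) (s : ιg → MvPolynomial σ ℝ) (q : ιh → MvPolynomial σ ℝ),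
    IsSOS s0 ∧ (∀ j, IsSOS (s j)) ∧
      p = s0 + ∑ j, g j * s j + ∑ j, h j * q j

/-- Membership in the degree-`ℓ` truncation of the quadratic module: all the SOS
multipliers and the polynomial multipliers have degree at most `ℓ`. -/
def InQMdeg {σ ιg ιh : Type*} [Fintype ιg] [Fintype ιh]
    (ℓ : ℕ) (g : ιg → MvPolynomial σ ℝ) (h : ιh → MvPolynomial σ ℝ)
    (p : MvPolynomial σ ℝ) : Prop :=
  ∃ (s0 : MvPolynomial σ ℝ) (s : ιg → MvPolynomial σ ℝ) (q : ιh → MvPolynomial σ ℝ),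
    IsSOS s0 ∧ (∀ j, IsSOS (s j)) ∧
      s0.totalDegree ≤ ℓ ∧ (∀ j, (s j).totalDegree ≤ ℓ) ∧ (∀ j, (q j).totalDegree ≤ ℓ) ∧
      p = s0 + ∑ j, g j * s j + ∑ j, h j * q j

/-- The basic semialgebraic set `{x | g j x ≥ 0 for all j, h j x = 0 for all j}`. -/
def semialgSet {m : ℕ} {ιg ιh : Type*} (g : ιg → MvPolynomial (Fin m) ℝ)
    (h : ιh → MvPolynomial (Fin m) ℝ) : Set (Fin m → ℝ) :=
  {x | (∀ j, 0 ≤ eval x (g j)) ∧ ∀ j, eval x (h j) = 0}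
/-- The `j`-th component of the pseudogradient of the game with payoffs `u`, where the
variable `j` belongs to player `π j`. -/
def pseudoGrad {m n : ℕ} (π : Fin m → Fin n) (u : Fin n → MvPolynomial (Fin m) ℝ)
    (j : Fin m) : MvPolynomial (Fin m) ℝ :=
  pderiv j (u (π j))

/-- Entry `(j, k)` of the symmetrized Jacobian `SJ = (J + Jᵀ)/2` of the pseudogradient. -/
def sjac {m n : ℕ} (π : Fin m → Fin n) (u : Fin n → MvPolynomial (Fin m) ℝ)
    (j k : Fin m) : MvPolynomial (Fin m) ℝ :=
  C (1 / 2 : ℝ) * (pderiv k (pseudoGrad π u j) + pderiv j (pseudoGrad π u k))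

/-- The quadratic form `yᵀ SJ(x) y` of the symmetrized Jacobian. -/
def sjForm {m n : ℕ} (π : Fin m → Fin n) (u : Fin n → MvPolynomial (Fin m) ℝ)
    (x y : Fin m → ℝ) : ℝ :=
  ∑ j, ∑ k, y j * y k * eval x (sjac π u j k)
/-- The inequality polynomials of `X`, viewed as polynomials in the variables `(x, y)`. -/
def liftIneq {m : ℕ} {ιg : Type*} (τ : Type*) (g : ιg → MvPolynomial (Fin m) ℝ) :
    ιg → MvPolynomial (Fin m ⊕ τ) ℝ :=
  fun j => rename Sum.inl (g j)

/-- The equality polynomials of `X` together with `1 - yᵀy`, viewed as polynomials in the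
variables `(x, y)`; together with `liftIneq` these define `X × B`. -/
def liftEq {m : ℕ} {ιh : Type*} (τ : Type*) [Fintype τ] (h : ιh → MvPolynomial (Fin m) ℝ) :
    ιh ⊕ Unit → MvPolynomial (Fin m ⊕ τ) ℝ :=
  Sum.elim (fun j => rename Sum.inl (h j)) (fun _ => 1 - ∑ t : τ, X (Sum.inr t) ^ 2)

/-- The polynomial `yᵀ SJ(x) y` in the variables `(x, y)`. -/
def sjFormPoly {m n : ℕ} (π : Fin m → Fin n) (u : Fin n → MvPolynomial (Fin m) ℝ) :
    MvPolynomial (Fin m ⊕ Fin m) ℝ :=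
  ∑ j, ∑ k, X (Sum.inr j) * X (Sum.inr k) * rename Sum.inl (sjac π u j k)

/-- A subset of a commutative ring containing `1`, closed under addition and under
multiplication by squares. -/
structure IsQuadraticModule {A : Type*} [CommRing A] (S : Set A) : Prop where
  one_mem : (1 : A) ∈ S
  add_mem : ∀ a ∈ S, ∀ b ∈ S, a + b ∈ S
  sq_mul_mem : ∀ a, ∀ b ∈ S, a ^ 2 * b ∈ S

namespace IsQuadraticModule

section Ring

variable {A : Type*} [CommRing A] {S : Set A}

theorem zero_mem (hS : IsQuadraticModule S) : (0 : A) ∈ S := by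
  simpa using hS.sq_mul_mem 0 1 hS.one_mem

theorem sq_mem (hS : IsQuadraticModule S) (a : A) : a ^ 2 ∈ S := by
  simpa using hS.sq_mul_mem a 1 hS.one_mem

theorem sumSq_mul_mem (hS : IsQuadraticModule S) {σ b : A} (hσ : IsSumSq σ) (hb : b ∈ S) :
    σ * b ∈ S := by
  induction hσ with
  | zero => simpa using hS.zero_mem
  | sq_add a _ ih =>
    have := hS.add_mem _ (hS.sq_mul_mem a b hb) _ ih
    convert this using 1
    ring

theorem sumSq_mem (hS : IsQuadraticModule S) {σ : A} (hσ : IsSumSq σ) : σ ∈ S := by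
  simpa using hS.sumSq_mul_mem hσ hS.one_mem

/-- The quadratic module generated by a quadratic module and one more element. -/
theorem adjoin (hS : IsQuadraticModule S) (a : A) :
    IsQuadraticModule {x | ∃ s ∈ S, ∃ σ, IsSumSq σ ∧ x = s + σ * a} where
  one_mem := ⟨1, hS.one_mem, 0, IsSumSq.zero, by simp⟩
  add_mem := by
    rintro _ ⟨s, hs, σ, hσ, rfl⟩ _ ⟨t, ht, τ, hτ, rfl⟩
    exact ⟨s + t, hS.add_mem _ hs _ ht, σ + τ, hσ.add hτ, by ring⟩
  sq_mul_mem := by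
    rintro b _ ⟨s, hs, σ, hσ, rfl⟩
    exact ⟨b ^ 2 * s, hS.sq_mul_mem _ _ hs, b * b * σ, (IsSumSq.mul_self b).mul hσ, by ring⟩

theorem exists_maximal (hS : IsQuadraticModule S) (h1 : (-1 : A) ∉ S) :
    ∃ T, S ⊆ T ∧ IsQuadraticModule T ∧ (-1 : A) ∉ T ∧
      ∀ U, IsQuadraticModule U → (-1 : A) ∉ U → T ⊆ U → U ⊆ T := by
  obtain ⟨T, hST, hT⟩ := zorn_subset_nonempty
    {T : Set A | IsQuadraticModule T ∧ (-1 : A) ∉ T} (by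
      intro c hc hchain hne
      refine ⟨⋃₀ c, ⟨⟨?_, ?_, ?_⟩, ?_⟩, fun s hs => Set.subset_sUnion_of_mem hs⟩
      · obtain ⟨s, hs⟩ := hne
        exact ⟨s, hs, (hc hs).1.one_mem⟩
      · rintro a ⟨s, hs, has⟩ b ⟨t, ht, hbt⟩
        rcases hchain.total hs ht with hst | hst
        · exact ⟨t, ht, (hc ht).1.add_mem _ (hst has) _ hbt⟩
        · exact ⟨s, hs, (hc hs).1.add_mem _ has _ (hst hbt)⟩
      · rintro a b ⟨s, hs, hbs⟩
        exact ⟨s, hs, (hc hs).1.sq_mul_mem a b hbs⟩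
      · rintro ⟨s, hs, h⟩
        exact (hc hs).2 h) S ⟨hS, h1⟩
  exact ⟨T, hST, hT.prop.1, hT.prop.2, fun U hU hU1 hTU => hT.le_of_ge ⟨hU, hU1⟩ hTU⟩

end Ring

variable {A : Type*} [CommRing A] [Algebra ℝ A] {S : Set A}

theorem const_mul_mem (hS : IsQuadraticModule S) {c : ℝ} (hc : 0 ≤ c) {a : A} (ha : a ∈ S) :
    algebraMap ℝ A c * a ∈ S := by
  have := hS.sq_mul_mem (algebraMap ℝ A √c) a ha
  rwa [← map_pow, Real.sq_sqrt hc] at this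

theorem const_mem (hS : IsQuadraticModule S) {c : ℝ} (hc : 0 ≤ c) : algebraMap ℝ A c ∈ S := by
  simpa using hS.const_mul_mem hc hS.one_mem

theorem mem_of_const_mul_mem (hS : IsQuadraticModule S) {c : ℝ} (hc : 0 < c) {a : A}
    (ha : algebraMap ℝ A c * a ∈ S) : a ∈ S := by
  have := hS.const_mul_mem (inv_pos.2 hc).le ha
  rwa [← mul_assoc, ← map_mul, inv_mul_cancel₀ hc.ne', map_one, one_mul] at this

theorem const_notMem (hS : IsQuadraticModule S) (h1 : (-1 : A) ∉ S) {c : ℝ} (hc : c < 0) :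
    algebraMap ℝ A c ∉ S := fun h => h1 <| hS.mem_of_const_mul_mem (neg_pos.2 hc) (by simpa using h)

/-- The support `S ∩ -S` of a quadratic module is an ideal. -/
theorem mul_mem_of_mem_of_neg_mem (hS : IsQuadraticModule S) {b : A} (hb : b ∈ S) (hb' : -b ∈ S)
    (a : A) : a * b ∈ S := by
  refine hS.mem_of_const_mul_mem (c := 4) (by norm_num) ?_
  have := hS.add_mem _ (hS.sq_mul_mem (a + 1) _ hb) _ (hS.sq_mul_mem (a - 1) _ hb')
  convert this using 1
  rw [map_ofNat]
  ring

/-- If `c ± a` lie in a quadratic module, then so does `c² - a²`. -/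
theorem sq_sub_sq_mem (hS : IsQuadraticModule S) {c : ℝ} (hc : 0 < c) {a : A}
    (h₁ : algebraMap ℝ A c - a ∈ S) (h₂ : algebraMap ℝ A c + a ∈ S) :
    algebraMap ℝ A (c ^ 2) - a ^ 2 ∈ S := by
  refine hS.mem_of_const_mul_mem (c := 2 * c) (by positivity) ?_
  have := hS.add_mem _ (hS.sq_mul_mem (algebraMap ℝ A c + a) _ h₁) _
    (hS.sq_mul_mem (algebraMap ℝ A c - a) _ h₂)
  convert this using 1
  rw [map_mul, map_pow, map_ofNat]
  ring

/-- A maximal proper quadratic module is a semiordering. -/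
theorem mem_or_neg_mem (hS : IsQuadraticModule S) (h1 : (-1 : A) ∉ S)
    (hmax : ∀ U, IsQuadraticModule U → (-1 : A) ∉ U → S ⊆ U → U ⊆ S) (a : A) :
    a ∈ S ∨ -a ∈ S := by
  have key : ∀ a, a ∉ S → ∃ s ∈ S, ∃ σ, IsSumSq σ ∧ (-1 : A) = s + σ * a := by
    intro a ha
    by_contra hcon
    refine ha (hmax _ (hS.adjoin a) hcon (fun s hs => ⟨s, hs, 0, IsSumSq.zero, by simp⟩) ?_)
    exact ⟨0, hS.zero_mem, 1, IsSumSq.one, by simp⟩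
  by_contra! hcon
  obtain ⟨s, hs, σ, hσ, h₁⟩ := key a hcon.1
  obtain ⟨t, ht, τ, hτ, h₂⟩ := key (-a) hcon.2
  have hneg : -σ ∈ S := by
    have := hS.add_mem _ (hS.add_mem _ (hS.sumSq_mul_mem hτ hs) _ (hS.sumSq_mul_mem hσ ht)) _
      (hS.sumSq_mem hτ)
    convert this using 1
    linear_combination τ * h₁ + σ * h₂
  apply h1
  rw [h₁, mul_comm σ]
  exact hS.add_mem _ hs _ (hS.mul_mem_of_mem_of_neg_mem (hS.sumSq_mem hσ) hneg a)

end IsQuadraticModule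

/-- `t` is the standard part of `a` with respect to the (semi)ordering `S`. -/
def IsStdPart {A : Type*} [CommRing A] [Algebra ℝ A] (S : Set A) (a : A) (t : ℝ) : Prop :=
  (∀ r < t, a - algebraMap ℝ A r ∈ S) ∧ ∀ r > t, algebraMap ℝ A r - a ∈ S

namespace IsStdPart

variable {A : Type*} [CommRing A] [Algebra ℝ A] {S : Set A} {a b : A} {s t : ℝ}

theorem le (hS : IsQuadraticModule S) (h1 : (-1 : A) ∉ S) (hs : IsStdPart S a s)
    (ht : IsStdPart S a t) : s ≤ t := by
  by_contra! hlt
  obtain ⟨r, h₁, h₂⟩ := exists_between hlt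
  obtain ⟨r', h₃, h₄⟩ := exists_between h₂
  refine hS.const_notMem h1 (sub_neg.2 h₃) ?_
  have := hS.add_mem _ (hs.1 r' h₄) _ (ht.2 r h₁)
  convert this using 1
  rw [map_sub]
  ring

theorem eq (hS : IsQuadraticModule S) (h1 : (-1 : A) ∉ S) (hs : IsStdPart S a s)
    (ht : IsStdPart S a t) : s = t :=
  le_antisymm (hs.le hS h1 ht) (ht.le hS h1 hs)

theorem exists_of_archimedean (hS : IsQuadraticModule S) (h1 : (-1 : A) ∉ S)
    (htot : ∀ a, a ∈ S ∨ -a ∈ S) (harch : ∀ a, ∃ r : ℝ, algebraMap ℝ A r - a ∈ S) (a : A) :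
    ∃ t, IsStdPart S a t := by
  have hbdd : BddAbove {r : ℝ | a - algebraMap ℝ A r ∈ S} := by
    obtain ⟨R, hR⟩ := harch a
    refine ⟨R, fun r hr => ?_⟩
    by_contra! hlt
    refine hS.const_notMem h1 (sub_neg.2 hlt) ?_
    have := hS.add_mem _ hR _ hr
    convert this using 1
    rw [map_sub]
    ring
  have hne : {r : ℝ | a - algebraMap ℝ A r ∈ S}.Nonempty := by
    obtain ⟨R, hR⟩ := harch (-a)
    refine ⟨-R, ?_⟩
    rw [Set.mem_ofPred_eq, map_neg]
    convert hR using 1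
    ring
  refine ⟨sSup {r : ℝ | a - algebraMap ℝ A r ∈ S}, fun r hr => ?_, fun r hr => ?_⟩
  · obtain ⟨r', hr', hlt⟩ := exists_lt_of_lt_csSup hne hr
    have := hS.add_mem _ hr' _ (hS.const_mem (sub_pos.2 hlt).le)
    convert this using 1
    rw [map_sub]
    ring
  · rcases htot (a - algebraMap ℝ A r) with h | h
    · exact absurd (le_csSup hbdd h) (not_le.2 hr)
    · rwa [neg_sub] at h

theorem const (hS : IsQuadraticModule S) (c : ℝ) : IsStdPart S (algebraMap ℝ A c) c :=
  ⟨fun r hr => by simpa using hS.const_mem (A := A) (sub_pos.2 hr).le,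
    fun r hr => by simpa using hS.const_mem (A := A) (sub_pos.2 hr).le⟩

theorem add (hS : IsQuadraticModule S) (ha : IsStdPart S a s) (hb : IsStdPart S b t) :
    IsStdPart S (a + b) (s + t) := by
  refine ⟨fun r hr => ?_, fun r hr => ?_⟩
  · have := hS.add_mem _ (ha.1 (s - (s + t - r) / 2) (by linarith)) _
      (hb.1 (t - (s + t - r) / 2) (by linarith))
    convert this using 1
    rw [show r = (s - (s + t - r) / 2) + (t - (s + t - r) / 2) by ring]
    rw [map_add]
    ring_nf
  · have := hS.add_mem _ (ha.2 (s - (s + t - r) / 2) (by linarith)) _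
      (hb.2 (t - (s + t - r) / 2) (by linarith))
    convert this using 1
    rw [show r = (s - (s + t - r) / 2) + (t - (s + t - r) / 2) by ring]
    rw [map_add]
    ring_nf

theorem neg (ha : IsStdPart S a s) : IsStdPart S (-a) (-s) := by
  refine ⟨fun r hr => ?_, fun r hr => ?_⟩
  · convert ha.2 (-r) (by linarith) using 1
    rw [map_neg]
    ring
  · convert ha.1 (-r) (by linarith) using 1
    rw [map_neg]
    ring

theorem const_mul_of_pos (hS : IsQuadraticModule S) {c : ℝ} (hc : 0 < c) (ha : IsStdPart S a s) :
    IsStdPart S (algebraMap ℝ A c * a) (c * s) := by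
  refine ⟨fun r hr => ?_, fun r hr => ?_⟩
  · convert hS.const_mul_mem hc.le (ha.1 (r / c) (by rw [div_lt_iff₀ hc]; linarith)) using 1
    rw [mul_sub, ← map_mul, mul_div_cancel₀ _ hc.ne']
  · convert hS.const_mul_mem hc.le
      (ha.2 (r / c) (by rw [gt_iff_lt, lt_div_iff₀ hc]; linarith)) using 1
    rw [mul_sub, ← map_mul, mul_div_cancel₀ _ hc.ne']

theorem const_mul (hS : IsQuadraticModule S) (c : ℝ) (ha : IsStdPart S a s) :
    IsStdPart S (algebraMap ℝ A c * a) (c * s) := by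
  rcases lt_trichotomy c 0 with hc | rfl | hc
  · simpa using (ha.const_mul_of_pos hS (neg_pos.2 hc)).neg
  · simpa using const (A := A) hS 0
  · exact ha.const_mul_of_pos hS hc

theorem sq_of_zero (hS : IsQuadraticModule S) (ha : IsStdPart S a 0) : IsStdPart S (a ^ 2) 0 := by
  refine ⟨fun r hr => ?_, fun r hr => ?_⟩
  · have := hS.add_mem _ (hS.sq_mem a) _ (hS.const_mem (neg_pos.2 hr).le)
    convert this using 1
    rw [map_neg]
    ring
  · have hr' : 0 < √r := Real.sqrt_pos.2 hr
    have := hS.sq_sub_sq_mem hr' (ha.2 _ hr') (by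
      convert ha.1 (-√r) (by linarith) using 1
      rw [map_neg]
      ring)
    rwa [Real.sq_sqrt (le_of_lt hr)] at this

theorem sq (hS : IsQuadraticModule S) (ha : IsStdPart S a s) : IsStdPart S (a ^ 2) (s ^ 2) := by
  have h0 : IsStdPart S (a + algebraMap ℝ A (-s)) 0 := by
    simpa using ha.add hS (const hS (-s))
  have := ((h0.sq_of_zero hS).add hS (ha.const_mul hS (2 * s))).add hS (const hS (-s ^ 2))
  convert this using 1
  · simp only [map_neg, map_mul, map_pow, map_ofNat]
    ring
  · ring

theorem mul (hS : IsQuadraticModule S) (ha : IsStdPart S a s) (hb : IsStdPart S b t) :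
    IsStdPart S (a * b) (s * t) := by
  have := (((ha.add hS hb).sq hS).add hS ((ha.add hS hb.neg).sq hS).neg).const_mul hS (1 / 4)
  convert this using 1
  · have h4 : algebraMap ℝ A (1 / 4) * 4 = 1 := by
      rw [← map_ofNat (algebraMap ℝ A) 4, ← map_mul]
      norm_num
    linear_combination -(a * b) * h4
  · ring

end IsStdPart

namespace IsQuadraticModule

variable {A : Type*} [CommRing A] [Algebra ℝ A] {S : Set A}

/-- A proper Archimedean quadratic module is nonnegative at some real point of the algebra. -/
theorem exists_algHom_nonneg (hS : IsQuadraticModule S) (h1 : (-1 : A) ∉ S)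
    (harch : ∀ a, ∃ r : ℝ, algebraMap ℝ A r - a ∈ S) :
    ∃ φ : A →ₐ[ℝ] ℝ, ∀ a ∈ S, 0 ≤ φ a := by
  obtain ⟨T, hST, hT, hT1, hmax⟩ := hS.exists_maximal h1
  choose φ hφ using IsStdPart.exists_of_archimedean hT hT1 (hT.mem_or_neg_mem hT1 hmax)
    (fun a => (harch a).imp fun r hr => hST hr)
  have hc : ∀ c : ℝ, φ (algebraMap ℝ A c) = c := fun c =>
    (hφ _).eq hT hT1 (IsStdPart.const hT c)
  refine ⟨⟨⟨⟨⟨φ, by simpa using hc 1⟩, fun a b => (hφ _).eq hT hT1 ((hφ a).mul hT (hφ b))⟩,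
    by simpa using hc 0, fun a b => (hφ _).eq hT hT1 ((hφ a).add hT (hφ b))⟩, hc⟩, ?_⟩
  intro a ha
  change 0 ≤ φ a
  by_contra! hlt
  obtain ⟨r, h₁, h₂⟩ := exists_between hlt
  refine hT.const_notMem hT1 h₂ ?_
  simpa using hT.add_mem _ ((hφ a).2 r h₁) _ (hST ha)

/-- If `σ p - 1` lies in an Archimedean quadratic module for a sum of squares `σ`, then so
does `p`. -/
theorem mem_of_sumSq_mul_sub_one_mem (hS : IsQuadraticModule S)
    (harch : ∀ a, ∃ r : ℝ, algebraMap ℝ A r - a ∈ S) {p σ : A} (hσ : IsSumSq σ)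
    (h : σ * p - 1 ∈ S) : p ∈ S := by
  obtain ⟨k, hk, hk₁, hk₂⟩ : ∃ k : ℝ, 0 < k ∧ algebraMap ℝ A (2 * k) - σ ∈ S ∧
      algebraMap ℝ A (2 * k - 1) - σ ^ 2 * p ∈ S := by
    obtain ⟨r₁, h₁⟩ := harch σ
    obtain ⟨r₂, h₂⟩ := harch (σ ^ 2 * p)
    refine ⟨|r₁| + |r₂| + 1, by positivity, ?_, ?_⟩
    · have := hS.add_mem _ h₁ _ (hS.const_mem (c := 2 * (|r₁| + |r₂| + 1) - r₁)
        (by linarith [le_abs_self r₁, abs_nonneg r₁, abs_nonneg r₂]))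
      convert this using 1
      rw [map_sub]
      ring
    · have := hS.add_mem _ h₂ _ (hS.const_mem (c := 2 * (|r₁| + |r₂| + 1) - 1 - r₂)
        (by linarith [le_abs_self r₂, abs_nonneg r₁, abs_nonneg r₂]))
      convert this using 1
      rw [map_sub _ _ r₂]
      ring
  have step : ∀ r : ℝ, 0 ≤ r → p + algebraMap ℝ A r ∈ S →
      p + algebraMap ℝ A (r - 1 / k ^ 2) ∈ S := by
    intro r hr hp
    refine hS.mem_of_const_mul_mem (c := k ^ 2) (by positivity) ?_
    have := hS.add_mem _ (hS.add_mem _ (hS.add_mem _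
      (hS.sq_mul_mem (algebraMap ℝ A k - σ) _ hp) _
      (hS.const_mul_mem (c := 2 * k) (by positivity) h)) _
      (hS.const_mul_mem hr (hS.sumSq_mul_mem hσ hk₁))) _ hk₂
    convert this using 1
    have hkk : algebraMap ℝ A (k ^ 2) * algebraMap ℝ A (1 / k ^ 2) = 1 := by
      rw [← map_mul, mul_one_div_cancel (by positivity), map_one]
    simp only [map_sub, map_mul, map_pow, map_ofNat, map_one] at hkk ⊢
    linear_combination -hkk
  obtain ⟨R, hR⟩ := harch (-p)
  have descend : ∀ N : ℕ, ∃ r : ℝ, r ≤ max 0 (R - N * (1 / k ^ 2)) ∧ p + algebraMap ℝ A r ∈ S := by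
    intro N
    induction N with
    | zero => exact ⟨R, by simp, by simpa [add_comm] using hR⟩
    | succ N ih =>
      obtain ⟨r, hr, hp⟩ := ih
      have hk' : 0 < 1 / k ^ 2 := by positivity
      rcases le_or_gt 0 r with h0 | h0
      · refine ⟨r - 1 / k ^ 2, ?_, step r h0 hp⟩
        push_cast
        rcases le_max_iff.1 hr with h | h
        · exact le_max_of_le_left (by linarith)
        · exact le_max_of_le_right (by linarith)
      · exact ⟨r, le_max_of_le_left h0.le, hp⟩
  obtain ⟨N, hN⟩ := exists_nat_ge (R * k ^ 2)
  obtain ⟨r, hr, hp⟩ := descend N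
  rw [max_eq_left] at hr
  · simpa using hS.add_mem _ hp _ (hS.const_mem (neg_nonneg.2 hr))
  · rw [mul_one_div, sub_nonpos, le_div_iff₀ (by positivity)]
    exact hN

/-- An element positive at all real points where an Archimedean quadratic module is nonnegative
belongs to the quadratic module. -/
theorem mem_of_forall_algHom_pos (hS : IsQuadraticModule S)
    (harch : ∀ a, ∃ r : ℝ, algebraMap ℝ A r - a ∈ S) {p : A}
    (hp : ∀ φ : A →ₐ[ℝ] ℝ, (∀ a ∈ S, 0 ≤ φ a) → 0 < φ p) : p ∈ S := by
  have hsub : S ⊆ {x | ∃ s ∈ S, ∃ σ, IsSumSq σ ∧ x = s + σ * -p} :=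
    fun s hs => ⟨s, hs, 0, IsSumSq.zero, by simp⟩
  by_cases h1 : (-1 : A) ∈ {x | ∃ s ∈ S, ∃ σ, IsSumSq σ ∧ x = s + σ * -p}
  · obtain ⟨s, hs, σ, hσ, h⟩ := h1
    refine hS.mem_of_sumSq_mul_sub_one_mem harch hσ ?_
    convert hs using 1
    linear_combination h
  · obtain ⟨φ, hφ⟩ := (hS.adjoin (-p)).exists_algHom_nonneg h1
      fun a => (harch a).imp fun r hr => hsub hr
    have h₁ := hp φ fun a ha => hφ a (hsub ha)
    have h₂ := hφ (-p) ⟨0, hS.zero_mem, 1, IsSumSq.one, by simp⟩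
    rw [map_neg] at h₂
    linarith

/-- A quadratic module of polynomials containing some `N - ∑ xᵢ²` is Archimedean. -/
theorem archimedean_of_ball {σ : Type*} [Fintype σ] {S : Set (MvPolynomial σ ℝ)}
    (hS : IsQuadraticModule S) {N : ℝ} (hN : C N - ∑ i, X i ^ 2 ∈ S) (a : MvPolynomial σ ℝ) :
    ∃ r : ℝ, algebraMap ℝ _ r - a ∈ S := by
  suffices h : ∃ r : ℝ, 0 < r ∧ algebraMap ℝ _ r - a ∈ S ∧ algebraMap ℝ _ r + a ∈ S from
    h.imp fun r hr => hr.2.1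
  have hadd : ∀ a b : MvPolynomial σ ℝ,
      (∃ r : ℝ, 0 < r ∧ algebraMap ℝ _ r - a ∈ S ∧ algebraMap ℝ _ r + a ∈ S) →
      (∃ r : ℝ, 0 < r ∧ algebraMap ℝ _ r - b ∈ S ∧ algebraMap ℝ _ r + b ∈ S) →
      ∃ r : ℝ, 0 < r ∧ algebraMap ℝ _ r - (a + b) ∈ S ∧ algebraMap ℝ _ r + (a + b) ∈ S := by
    rintro a b ⟨r, hr, h₁, h₂⟩ ⟨t, ht, h₃, h₄⟩
    refine ⟨r + t, by positivity, ?_, ?_⟩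
    · convert hS.add_mem _ h₁ _ h₃ using 1
      rw [map_add]
      ring
    · convert hS.add_mem _ h₂ _ h₄ using 1
      rw [map_add]
      ring
  have hneg : ∀ a : MvPolynomial σ ℝ,
      (∃ r : ℝ, 0 < r ∧ algebraMap ℝ _ r - a ∈ S ∧ algebraMap ℝ _ r + a ∈ S) →
      ∃ r : ℝ, 0 < r ∧ algebraMap ℝ _ r - -a ∈ S ∧ algebraMap ℝ _ r + -a ∈ S := by
    rintro a ⟨r, hr, h₁, h₂⟩
    exact ⟨r, hr, by rwa [sub_neg_eq_add], by rwa [← sub_eq_add_neg]⟩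
  have hsq : ∀ a : MvPolynomial σ ℝ,
      (∃ r : ℝ, 0 < r ∧ algebraMap ℝ _ r - a ∈ S ∧ algebraMap ℝ _ r + a ∈ S) →
      ∃ r : ℝ, 0 < r ∧ algebraMap ℝ _ r - a ^ 2 ∈ S ∧ algebraMap ℝ _ r + a ^ 2 ∈ S := by
    rintro a ⟨r, hr, h₁, h₂⟩
    exact ⟨r ^ 2, by positivity, hS.sq_sub_sq_mem hr h₁ h₂,
      hS.add_mem _ (hS.const_mem (by positivity)) _ (hS.sq_mem a)⟩
  have hquarter : ∀ a : MvPolynomial σ ℝ,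
      (∃ r : ℝ, 0 < r ∧ algebraMap ℝ _ r - 4 * a ∈ S ∧ algebraMap ℝ _ r + 4 * a ∈ S) →
      ∃ r : ℝ, 0 < r ∧ algebraMap ℝ _ r - a ∈ S ∧ algebraMap ℝ _ r + a ∈ S := by
    rintro a ⟨r, hr, h₁, h₂⟩
    refine ⟨r / 4, by positivity, hS.mem_of_const_mul_mem (c := 4) (by norm_num) ?_,
      hS.mem_of_const_mul_mem (c := 4) (by norm_num) ?_⟩
    · convert h₁ using 1
      rw [mul_sub, ← map_mul, mul_div_cancel₀ _ (by norm_num), map_ofNat]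
    · convert h₂ using 1
      rw [mul_add, ← map_mul, mul_div_cancel₀ _ (by norm_num), map_ofNat]
  have hX : ∀ i : σ, ∃ r : ℝ, 0 < r ∧ algebraMap ℝ (MvPolynomial σ ℝ) r - X i ∈ S ∧
      algebraMap ℝ (MvPolynomial σ ℝ) r + X i ∈ S := by
    classical
    intro i
    have hsum : ∀ t : Finset σ, ∑ j ∈ t, (X j : MvPolynomial σ ℝ) ^ 2 ∈ S := fun t =>
      Finset.sum_induction _ (· ∈ S) (fun a b ha hb => hS.add_mem a ha b hb) hS.zero_mem
        fun j _ => hS.sq_mem _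
    have h₀ : algebraMap ℝ (MvPolynomial σ ℝ) N - X i ^ 2 ∈ S := by
      convert hS.add_mem _ hN _ (hsum (univ.erase i)) using 1
      rw [← Finset.add_sum_erase univ _ (mem_univ i), algebraMap_eq]
      ring
    have hhalf : algebraMap ℝ (MvPolynomial σ ℝ) (1 / 2) * 2 = 1 := by
      rw [← map_ofNat (algebraMap ℝ (MvPolynomial σ ℝ)) 2, ← map_mul]
      norm_num
    have h₁ := hS.const_mem (A := MvPolynomial σ ℝ) (c := |N| - N)
      (sub_nonneg.2 (le_abs_self N))
    refine ⟨|N| + (1 / 2) ^ 2, by positivity, ?_, ?_⟩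
    · convert hS.add_mem _ (hS.add_mem _ h₀ _ h₁) _ (hS.sq_mem (X i - algebraMap ℝ _ (1 / 2)))
        using 1
      rw [map_sub, map_add, map_pow]
      linear_combination X i * hhalf
    · convert hS.add_mem _ (hS.add_mem _ h₀ _ h₁) _ (hS.sq_mem (X i + algebraMap ℝ _ (1 / 2)))
        using 1
      rw [map_sub, map_add, map_pow]
      linear_combination - X i * hhalf
  have hmul : ∀ a b : MvPolynomial σ ℝ,
      (∃ r : ℝ, 0 < r ∧ algebraMap ℝ _ r - a ∈ S ∧ algebraMap ℝ _ r + a ∈ S) →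
      (∃ r : ℝ, 0 < r ∧ algebraMap ℝ _ r - b ∈ S ∧ algebraMap ℝ _ r + b ∈ S) →
      ∃ r : ℝ, 0 < r ∧ algebraMap ℝ _ r - a * b ∈ S ∧ algebraMap ℝ _ r + a * b ∈ S := by
    intro a b ha hb
    apply hquarter
    rw [show 4 * (a * b) = (a + b) ^ 2 + -(a + -b) ^ 2 by ring]
    exact hadd _ _ (hsq _ (hadd _ _ ha hb)) (hneg _ (hsq _ (hadd _ _ ha (hneg _ hb))))
  induction a using MvPolynomial.induction_on with
  | C c =>
    refine ⟨|c| + 1, by positivity, ?_, ?_⟩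
    · rw [← algebraMap_eq, ← map_sub]
      exact hS.const_mem (by linarith [le_abs_self c])
    · rw [← algebraMap_eq, ← map_add]
      exact hS.const_mem (by linarith [neg_abs_le c])
  | add a b ha hb => exact hadd a b ha hb
  | mul_X a i ha => exact hmul a (X i) ha (hX i)

end IsQuadraticModule

section SOS

variable {σ : Type*}

theorem isSOS_iff_isSumSq {p : MvPolynomial σ ℝ} : IsSOS p ↔ IsSumSq p := by
  constructor
  · rintro ⟨k, q, rfl⟩
    exact IsSumSq.sum_sq univ q
  · intro hp
    induction hp with
    | zero => exact ⟨0, Fin.elim0, by simp⟩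
    | sq_add a _ ih =>
      obtain ⟨k, q, rfl⟩ := ih
      exact ⟨k + 1, Fin.cons a q, by simp [Fin.sum_univ_succ, pow_two]⟩

theorem isSOS_zero : IsSOS (0 : MvPolynomial σ ℝ) := isSOS_iff_isSumSq.2 IsSumSq.zero

theorem isSOS_one : IsSOS (1 : MvPolynomial σ ℝ) := isSOS_iff_isSumSq.2 IsSumSq.one

theorem IsSOS.add {p q : MvPolynomial σ ℝ} (hp : IsSOS p) (hq : IsSOS q) : IsSOS (p + q) :=
  isSOS_iff_isSumSq.2 ((isSOS_iff_isSumSq.1 hp).add (isSOS_iff_isSumSq.1 hq))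

theorem IsSOS.sq_mul {p : MvPolynomial σ ℝ} (hp : IsSOS p) (a : MvPolynomial σ ℝ) :
    IsSOS (a ^ 2 * p) :=
  isSOS_iff_isSumSq.2 (pow_two a ▸ (IsSumSq.mul_self a).mul (isSOS_iff_isSumSq.1 hp))

theorem IsSOS.rename {τ : Type*} {p : MvPolynomial σ ℝ} (hp : IsSOS p) (f : σ → τ) :
    IsSOS (MvPolynomial.rename f p) := by
  obtain ⟨k, q, rfl⟩ := hp
  exact ⟨k, fun i => MvPolynomial.rename f (q i), by simp⟩

end SOS

section InQM

variable {σ ιg ιh : Type*} [Fintype ιg] [Fintype ιh]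
  {g : ιg → MvPolynomial σ ℝ} {h : ιh → MvPolynomial σ ℝ} {p : MvPolynomial σ ℝ}

theorem isQuadraticModule_inQM (g : ιg → MvPolynomial σ ℝ) (h : ιh → MvPolynomial σ ℝ) :
    IsQuadraticModule {p | InQM g h p} where
  one_mem := ⟨1, 0, 0, isSOS_one, fun _ => isSOS_zero, by simp⟩
  add_mem := by
    rintro _ ⟨s0, s, q, hs0, hs, rfl⟩ _ ⟨t0, t, r, ht0, ht, rfl⟩
    refine ⟨s0 + t0, s + t, q + r, hs0.add ht0, fun j => (hs j).add (ht j), ?_⟩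
    simp only [Pi.add_apply, mul_add, sum_add_distrib]
    ring
  sq_mul_mem := by
    rintro a _ ⟨s0, s, q, hs0, hs, rfl⟩
    refine ⟨a ^ 2 * s0, fun j => a ^ 2 * s j, fun j => a ^ 2 * q j, hs0.sq_mul a,
      fun j => (hs j).sq_mul a, ?_⟩
    simp only [mul_add, mul_sum, mul_left_comm]

theorem inQM_ineq (j : ιg) : InQM g h (g j) := by
  classical
  refine ⟨0, Pi.single j 1, 0, isSOS_zero, fun i => ?_, by simp [Pi.single_apply]⟩
  rcases eq_or_ne i j with rfl | hij
  · simpa using isSOS_one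
  · simpa [hij] using isSOS_zero

theorem inQM_eq_mul (j : ιh) (a : MvPolynomial σ ℝ) : InQM g h (h j * a) := by
  classical
  exact ⟨0, 0, Pi.single j a, isSOS_zero, fun _ => isSOS_zero, by simp [Pi.single_apply]⟩

theorem InQM.exists_inQMdeg (hp : InQM g h p) : ∃ ℓ, InQMdeg ℓ g h p := by
  obtain ⟨s0, s, q, hs0, hs, rfl⟩ := hp
  refine ⟨s0.totalDegree + ∑ j, (s j).totalDegree + ∑ j, (q j).totalDegree, s0, s, q, hs0, hs,
    by omega, fun j => ?_, fun j => ?_, rfl⟩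
  · have := single_le_sum (f := fun j => (s j).totalDegree) (fun _ _ => Nat.zero_le _) (mem_univ j)
    omega
  · have := single_le_sum (f := fun j => (q j).totalDegree) (fun _ _ => Nat.zero_le _) (mem_univ j)
    omega

/-- **Putinar's Positivstellensatz.** -/
theorem inQM_of_pos [Fintype σ] {N : ℝ} (hN : InQM g h (C N - ∑ i, X i ^ 2))
    (hp : ∀ x : σ → ℝ, (∀ j, 0 ≤ eval x (g j)) → (∀ j, eval x (h j) = 0) → 0 < eval x p) :
    InQM g h p := by
  have hQ := isQuadraticModule_inQM g h
  refine hQ.mem_of_forall_algHom_pos (hQ.archimedean_of_ball hN) fun φ hφ => ?_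
  have heval : ∀ q, φ q = eval (fun i => φ (X i)) q := by
    intro q
    have : φ = aeval fun i => φ (X i) := by
      ext i
      simp
    exact (DFunLike.congr_fun this q).trans (by rw [aeval_eq_eval])
  rw [heval]
  refine hp _ (fun j => ?_) fun j => ?_
  · rw [← heval]
    exact hφ _ (inQM_ineq j)
  · rw [← heval]
    have h₁ := hφ _ (inQM_eq_mul j 1)
    have h₂ := hφ _ (inQM_eq_mul j (-1))
    rw [map_mul, map_one] at h₁
    rw [map_mul, map_neg, map_one] at h₂
    linarith

/-- The quadratic module of `X × B` is Archimedean when that of `X` is. -/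
theorem InQM.lift_ball {m : ℕ} {g : ιg → MvPolynomial (Fin m) ℝ} {h : ιh → MvPolynomial (Fin m) ℝ}
    {N : ℝ} {τ : Type*} [Fintype τ] (hN : InQM g h (C N - ∑ i, X i ^ 2)) :
    InQM (liftIneq τ g) (liftEq τ h) (C (N + 1) - ∑ i, X i ^ 2) := by
  obtain ⟨s0, s, q, hs0, hs, heq⟩ := hN
  refine ⟨rename Sum.inl s0, fun j => rename Sum.inl (s j),
    Sum.elim (fun j => rename Sum.inl (q j)) 1, hs0.rename _, fun j => (hs j).rename _, ?_⟩
  have := congrArg (rename (Sum.inl : Fin m → Fin m ⊕ τ)) heq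
  simp only [map_sub, map_add, map_sum, map_mul, map_pow, rename_C, rename_X] at this
  simp only [liftIneq, liftEq, Fintype.sum_sum_type, Sum.elim_inl, Sum.elim_inr, Pi.one_apply,
    univ_unique, sum_singleton, C_add, C_1, mul_one]
  linear_combination this

end InQM

section Game

variable {m n : ℕ} (π : Fin m → Fin n) (u : Fin n → MvPolynomial (Fin m) ℝ)

theorem eval_sjFormPoly (z : Fin m ⊕ Fin m → ℝ) :
    eval z (sjFormPoly π u) = sjForm π u (fun j => z (Sum.inl j)) (fun j => z (Sum.inr j)) := by
  simp [sjFormPoly, sjForm, eval_rename, Function.comp_def]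

/-- The game with the concave term `-δ ∑ xⱼ²`, over the variables of player `i`, added to the
payoff of each player `i`. -/
def concavePerturb (δ : ℝ) (i : Fin n) : MvPolynomial (Fin m) ℝ :=
  u i - C δ * ∑ j, if π j = i then X j ^ 2 else 0

theorem sjac_concavePerturb (δ : ℝ) (j k : Fin m) :
    sjac π (concavePerturb π u δ) j k = sjac π u j k - if j = k then C (2 * δ) else 0 := by
  have key : ∀ a b : Fin m, pderiv b (pseudoGrad π (concavePerturb π u δ) a) =
      pderiv b (pseudoGrad π u a) - if a = b then C (2 * δ) else 0 := by
    intro a b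
    have h₁ : pderiv a (∑ l, if π l = π a then (X l : MvPolynomial (Fin m) ℝ) ^ 2 else 0) =
        2 * X a := by
      rw [map_sum, Finset.sum_eq_single a]
      · simp [Derivation.leibniz_pow]
      · intro l _ hl
        split_ifs
        · simp [Derivation.leibniz_pow, pderiv_X_of_ne hl]
        · simp
      · simp
    have h₂ : pseudoGrad π (concavePerturb π u δ) a = pseudoGrad π u a - C (2 * δ) * X a := by
      simp only [pseudoGrad, concavePerturb, map_sub, pderiv_C_mul, h₁, C_mul]
      rw [map_ofNat]
      ring
    rw [h₂, map_sub, pderiv_C_mul]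
    rcases eq_or_ne a b with rfl | hab
    · simp
    · simp [hab, pderiv_X_of_ne hab]
  have hhalf : (C (1 / 2 : ℝ) : MvPolynomial (Fin m) ℝ) * 2 = 1 := by
    rw [← map_ofNat (C : ℝ →+* MvPolynomial (Fin m) ℝ) 2, ← C_mul]
    norm_num
  simp only [sjac, key]
  rcases eq_or_ne j k with rfl | hjk
  · simp only [if_true]
    linear_combination -C (2 * δ) * hhalf
  · simp [hjk, hjk.symm]

theorem sjForm_concavePerturb (δ : ℝ) (x y : Fin m → ℝ) :
    sjForm π (concavePerturb π u δ) x y = sjForm π u x y - 2 * δ * ∑ j, y j ^ 2 := by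
  simp only [sjForm, sjac_concavePerturb, map_sub, mul_sub, sum_sub_distrib, mul_sum]
  congr 1
  refine sum_congr rfl fun j _ => ?_
  rw [Finset.sum_eq_single j]
  · simp
    ring
  · intro k _ hk
    simp [hk.symm]
  · simp

theorem totalDegree_concavePerturb_le {d : ℕ} (hd : 2 ≤ d) (δ : ℝ) {i : Fin n}
    (hu : (u i).totalDegree ≤ d) : (concavePerturb π u δ i).totalDegree ≤ d := by
  refine (totalDegree_sub _ _).trans (max_le hu ((totalDegree_mul _ _).trans ?_))
  rw [totalDegree_C, zero_add]
  refine totalDegree_finsetSum_le fun j _ => ?_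
  split_ifs
  · rwa [totalDegree_X_pow]
  · simp

theorem abs_coeff_sub_concavePerturb_le {δ : ℝ} (hδ : 0 ≤ δ) (i : Fin n) (s : Fin m →₀ ℕ) :
    |coeff s (u i) - coeff s (concavePerturb π u δ i)| ≤ δ * m := by
  rw [concavePerturb, coeff_sub, sub_sub_cancel, coeff_C_mul, abs_mul, abs_of_nonneg hδ,
    coeff_sum]
  refine mul_le_mul_of_nonneg_left ((abs_sum_le_sum_abs _ _).trans ?_) hδ
  refine (sum_le_card_nsmul _ _ 1 fun j _ => ?_).trans (by simp)
  split_ifs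
  · rw [coeff_X_pow]
    split_ifs <;> simp
  · simp

end Game

/-- For `d ≥ 2` and a compact basic semialgebraic set `X` whose quadratic
module is Archimedean, SOS-monotone games of degree `d` are dense in monotone games of
degree `d`: for every monotone degree-`d` game `u` and every `ε > 0` there is a degree-`d`
game `u'` which is SOS-monotone and whose coefficients are all within `ε` of those of `u`
(i.e. `max_i ‖coeffs(u_i) − coeffs(u'_i)‖_∞ ≤ ε`). -/
theorem sos_monotone_games_dense_in_monotone_games {m n mg mh : ℕ} (d : ℕ) (hd : 2 ≤ d)
    (π : Fin m → Fin n)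
    (g : Fin mg → MvPolynomial (Fin m) ℝ) (h : Fin mh → MvPolynomial (Fin m) ℝ)
    (hX : IsCompact (semialgSet g h))
    (hArch : ∃ N : ℕ, InQM g h (C (N : ℝ) - ∑ i, X i ^ 2))
    (u : Fin n → MvPolynomial (Fin m) ℝ) (hdeg : ∀ i, (u i).totalDegree ≤ d)
    (hmono : ∀ x ∈ semialgSet g h, ∀ y : Fin m → ℝ, sjForm π u x y ≤ 0)
    (ε : ℝ) (hε : 0 < ε) :
    ∃ u' : Fin n → MvPolynomial (Fin m) ℝ,
      (∀ i, (u' i).totalDegree ≤ d) ∧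
      (∃ ℓ : ℕ, InQMdeg ℓ (liftIneq (Fin m) g) (liftEq (Fin m) h) (- sjFormPoly π u')) ∧
      ∀ (i : Fin n) (s : Fin m →₀ ℕ), |coeff s (u i) - coeff s (u' i)| ≤ ε := by
  obtain ⟨N, hN⟩ := hArch
  have hδ : 0 < ε / (m + 1) := by positivity
  refine ⟨concavePerturb π u (ε / (m + 1)),
    fun i => totalDegree_concavePerturb_le π u hd _ (hdeg i), ?_, fun i s => ?_⟩
  · refine (inQM_of_pos hN.lift_ball fun z hg hh => ?_).exists_inQMdeg
    rw [map_neg, eval_sjFormPoly, sjForm_concavePerturb]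
    have hz : (fun j => z (Sum.inl j)) ∈ semialgSet g h := by
      refine ⟨fun j => ?_, fun j => ?_⟩
      · simpa [liftIneq, eval_rename, Function.comp_def] using hg j
      · simpa [liftEq, eval_rename, Function.comp_def] using hh (Sum.inl j)
    have hy : ∑ j, z (Sum.inr j) ^ 2 = 1 := by
      have := hh (Sum.inr ())
      simp [liftEq] at this
      linarith
    have := hmono _ hz fun j => z (Sum.inr j)
    rw [hy]
    linarith
  · refine (abs_coeff_sub_concavePerturb_le π u hδ.le i s).trans ?_
    rw [div_mul_eq_mul_div, div_le_iff₀ (by positivity)]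
    nlinarith

end
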